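/- Let Y be a real Banach space. Suppose there exist a 1-norming set B ⊆ S_{Y*} and a function ρ : (0,1) → (0,1) with 0 < ρ(ε) < ε such that for every 0 < ε < 1, every (y₁,y₂,y₃,y₄) ∈ M_Y^4, every nonempty A ⊆ {1,2,3,4}, and every y* ∈ B with y*(y_i) > 1 − ρ(ε) for all i ∈ A, there exists (z₁,z₂,z₃,z₄) ∈ M_Y^4 with ‖z_i − y_i‖ < ε for all i ≤ 4 and ‖∑_{i∈A} z_i‖ = |A|. Then Y satisfies condition (3) with the function ν = ρ². -/

import Mathlib

/-- `M_Y^4`: quadruples `(y₁,y₂,y₃,y₄)` in the closed unit ball of `Y` such that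
`‖y_{i₁} − y_{i₂} + y_{i₃}‖ ≤ 1` for all `i₁ < i₂ < i₃`. -/
def MY4 {Y : Type*} [NormedAddCommGroup Y] (y : Fin 4 → Y) : Prop :=
  (∀ i, ‖y i‖ ≤ 1) ∧
    ∀ i j k : Fin 4, i < j → j < k → ‖y i - y j + y k‖ ≤ 1

/-- Condition (3) of Proposition 2.9 for `Y` with the function `ν`. -/
def Cond3With (Y : Type*) [NormedAddCommGroup Y] [NormedSpace ℝ Y] (ν : ℝ → ℝ) : Prop :=
  ∀ ε : ℝ, 0 < ε → ε < 1 →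
    (0 < ν ε ∧ ν ε < ε) ∧
    ∀ y : Fin 4 → Y, MY4 y →
      ∀ α : Fin 4 → ℝ, (∀ i, 0 ≤ α i) → (∑ i, α i) = 1 →
        1 - ν ε < ‖∑ i, α i • y i‖ →
        ∃ A : Finset (Fin 4), ∃ z : Fin 4 → Y, MY4 z ∧
          1 - ε < (∑ i ∈ A, α i) ∧ (∀ i, ‖z i - y i‖ < ε) ∧
          ‖∑ i ∈ A, z i‖ = (A.card : ℝ)

theorem MY4.neg {Y : Type*} [NormedAddCommGroup Y] {y : Fin 4 → Y} (hy : MY4 y) :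
    MY4 (fun i => -y i) := by
  refine ⟨fun i => by simpa using hy.1 i, fun i j k hij hjk => ?_⟩
  have e : -y i - -y j + -y k = -(y i - y j + y k) := by abel
  rw [e, norm_neg]
  exact hy.2 i j k hij hjk

/-- If a convex combination of numbers `t i ≤ 1` exceeds `1 - r ^ 2`, then the total weight of the
indices with `t i > 1 - r` exceeds `1 - r`. -/
theorem one_sub_lt_sum_filter_of_one_sub_sq_lt {ι : Type*} [Fintype ι] {r : ℝ} (hr : 0 < r)
    {α t : ι → ℝ} (hα : ∀ i, 0 ≤ α i) (hα1 : ∑ i, α i = 1) (ht : ∀ i, t i ≤ 1)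
    (hs : 1 - r ^ 2 < ∑ i, α i * t i) :
    1 - r < ∑ i with 1 - r < t i, α i := by
  have h1 : ∑ i, α i * t i ≤ ∑ i, (α i * (1 - r) + r * (if 1 - r < t i then α i else 0)) := by
    refine Finset.sum_le_sum fun i _ => ?_
    split_ifs with hi
    · nlinarith [mul_le_mul_of_nonneg_left (ht i) (hα i)]
    · nlinarith [mul_le_mul_of_nonneg_left (not_lt.mp hi) (hα i)]
  rw [Finset.sum_add_distrib, ← Finset.sum_mul, ← Finset.mul_sum, hα1, ← Finset.sum_filter] at h1
  nlinarith

/-- If there are a 1-norming set `B ⊆ S_{Y*}` and a function `ρ` with `0 < ρ(ε) < ε`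
satisfying the AHSp-`ℓ∞⁴` condition for every `y* ∈ B`, then `Y` satisfies
condition (3) with the function `ν = ρ²`. -/
theorem stmt2 (Y : Type*) [NormedAddCommGroup Y] [NormedSpace ℝ Y] [CompleteSpace Y]
    (B : Set (Y →L[ℝ] ℝ)) (hB : ∀ f ∈ B, ‖f‖ = 1)
    (hnorming : ∀ y : Y, ‖y‖ = ⨆ f : B, |f.1 y|)
    (ρ : ℝ → ℝ) (hρ : ∀ ε : ℝ, 0 < ε → ε < 1 → 0 < ρ ε ∧ ρ ε < ε)
    (h : ∀ ε : ℝ, 0 < ε → ε < 1 →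
      ∀ y : Fin 4 → Y, MY4 y →
        ∀ A : Finset (Fin 4), A.Nonempty →
          ∀ f ∈ B, (∀ i ∈ A, 1 - ρ ε < f (y i)) →
            ∃ z : Fin 4 → Y, MY4 z ∧ (∀ i, ‖z i - y i‖ < ε) ∧
              ‖∑ i ∈ A, z i‖ = (A.card : ℝ)) :
    Cond3With Y (fun ε => (ρ ε) ^ 2) := by
  intro ε hε hε1
  obtain ⟨hr, hrε⟩ := hρ ε hε hε1
  refine ⟨⟨by positivity, by nlinarith⟩, ?_⟩
  intro y hy α hα hα1 hs
  have key : ∀ u : Fin 4 → Y, MY4 u → ∀ f ∈ B, 1 - ρ ε ^ 2 < f (∑ i, α i • u i) →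
      ∃ A : Finset (Fin 4), ∃ z : Fin 4 → Y, MY4 z ∧
        1 - ε < (∑ i ∈ A, α i) ∧ (∀ i, ‖z i - u i‖ < ε) ∧ ‖∑ i ∈ A, z i‖ = (A.card : ℝ) := by
    intro u hu f hf hfu
    have ht : ∀ i, f (u i) ≤ 1 := fun i =>
      (le_abs_self _).trans <| (f.le_of_opNorm_le_of_le (hB f hf).le (hu.1 i)).trans_eq (one_mul 1)
    simp only [map_sum, map_smul, smul_eq_mul] at hfu
    have hA := one_sub_lt_sum_filter_of_one_sub_sq_lt hr hα hα1 ht hfu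
    have hne : (Finset.univ.filter fun i => 1 - ρ ε < f (u i)).Nonempty := by
      rw [Finset.nonempty_iff_ne_empty]
      intro he
      rw [he, Finset.sum_empty] at hA
      linarith
    obtain ⟨z, hz, hzu, hzA⟩ := h ε hε hε1 u hu _ hne f hf fun i hi => (Finset.mem_filter.mp hi).2
    exact ⟨_, z, hz, by linarith, hzu, hzA⟩
  obtain ⟨f, hf, hfs⟩ : ∃ f ∈ B, 1 - ρ ε ^ 2 < |f (∑ i, α i • y i)| := by
    by_contra! hc
    refine hs.not_ge ?_
    rw [hnorming]
    exact Real.iSup_le (fun f => hc f.1 f.2) (by nlinarith)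
  rcases lt_abs.mp hfs with hpos | hneg
  · exact key y hy f hf hpos
  · obtain ⟨A, z, hz, hA, hzy, hzA⟩ := key (fun i => -y i) hy.neg f hf (by simpa using hneg)
    refine ⟨A, fun i => -z i, hz.neg, hA, fun i => ?_, by simpa using hzA⟩
    rw [← norm_neg]
    simpa [sub_eq_add_neg, add_comm] using hzy i
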